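/- arXiv:math/0409017 — 6 statements merged into one kernel-verified Lean document; each statement's English description precedes it below -/
import Mathlib

section
/- Let n ≥ 1 and let f ∈ L¹_loc(ℝⁿ). Then Mf = f Lebesgue-almost everywhere if and only if f ≥ 0 almost everywhere and for almost every x ∈ ℝⁿ one has (1/|B(x,r)|)∫_{B(x,r)} f(y) dy ≤ f(x) for every r > 0 (i.e., f satisfies the super-mean-value inequality on all balls at almost every center). -/
open MeasureTheory Metric ENNReal

/-- The centered Hardy–Littlewood maximal operator on `ℝⁿ`, with values in `ℝ≥0∞`:
`Mf(x) = sup_{r>0} (1/|B(x,r)|) ∫_{B(x,r)} |f(y)| dy`. -/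
noncomputable def centeredMaximal {n : ℕ} (f : EuclideanSpace ℝ (Fin n) → ℝ)
    (x : EuclideanSpace ℝ (Fin n)) : ℝ≥0∞ :=
  ⨆ (r : ℝ) (_ : 0 < r),
    (∫⁻ y in ball x r, ENNReal.ofReal |f y| ∂volume) / volume (ball x r)

open Filter Topology

/-- Lebesgue differentiation along shrinking open balls centered at the point. -/
theorem ae_tendsto_setAverage_ball {E F : Type*} [NormedAddCommGroup E] [NormedSpace ℝ E]
    [FiniteDimensional ℝ E] [MeasurableSpace E] [BorelSpace E] (μ : Measure E)
    [μ.IsAddHaarMeasure] [NormedAddCommGroup F] [NormedSpace ℝ F] [CompleteSpace F]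
    {f : E → F} (hf : LocallyIntegrable f μ) :
    ∀ᵐ x ∂μ, Tendsto (fun r : ℝ => ⨍ y in ball x r, f y ∂μ) (𝓝[>] 0) (𝓝 (f x)) := by
  have : ProperSpace E := FiniteDimensional.proper ℝ E
  filter_upwards [IsUnifLocDoublingMeasure.ae_tendsto_average μ hf 1] with x hx
  have hmem : ∀ᶠ r : ℝ in 𝓝[>] 0, x ∈ closedBall x (1 * r) := by
    filter_upwards [self_mem_nhdsWithin] with r hr
    exact mem_closedBall_self (by simpa using (Set.mem_Ioi.mp hr).le)
  refine (hx (fun _ => x) id tendsto_id hmem).congr' ?_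
  filter_upwards [self_mem_nhdsWithin] with r hr
  refine setAverage_congr (ae_eq_set.2 ⟨?_, ?_⟩)
  · rw [id, closedBall_sdiff_ball]
    exact Measure.addHaar_sphere_of_ne_zero μ x (Set.mem_Ioi.mp hr).ne'
  · rw [id, Set.sdiff_eq_empty.2 ball_subset_closedBall, measure_empty]

theorem MeasureTheory.LocallyIntegrable.integrableOn_ball {E F : Type*} [PseudoMetricSpace E] [ProperSpace E]
    [MeasurableSpace E] {μ : Measure E} [NormedAddCommGroup F] {f : E → F}
    (hf : LocallyIntegrable f μ) (x : E) (r : ℝ) : IntegrableOn f (ball x r) μ :=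
  (hf.integrableOn_isCompact (isCompact_closedBall x r)).mono_set ball_subset_closedBall

theorem centeredMaximal_eq_iSup_ofReal_setAverage {n : ℕ} {f : EuclideanSpace ℝ (Fin n) → ℝ}
    (hf : LocallyIntegrable f volume) (x : EuclideanSpace ℝ (Fin n)) :
    centeredMaximal f x = ⨆ (r : ℝ) (_ : 0 < r), ENNReal.ofReal (⨍ y in ball x r, |f y|) := by
  refine iSup_congr fun r => iSup_congr fun _ => (ofReal_setAverage ?_ ?_).symm
  · exact (hf.integrableOn_ball x r).abs
  · exact ae_of_all _ fun y => abs_nonneg (f y)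

theorem ae_ofReal_abs_le_centeredMaximal {n : ℕ} {f : EuclideanSpace ℝ (Fin n) → ℝ}
    (hf : LocallyIntegrable f volume) :
    ∀ᵐ x ∂(volume : Measure (EuclideanSpace ℝ (Fin n))),
      ENNReal.ofReal |f x| ≤ centeredMaximal f x := by
  have habs : LocallyIntegrable (fun y => |f y|) volume := fun x =>
    let ⟨s, hs, hfs⟩ := hf x
    ⟨s, hs, hfs.abs⟩
  filter_upwards [ae_tendsto_setAverage_ball volume habs] with x hx
  rw [centeredMaximal_eq_iSup_ofReal_setAverage hf]
  refine le_of_tendsto (ENNReal.tendsto_ofReal hx) ?_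
  filter_upwards [self_mem_nhdsWithin] with r hr
  exact le_iSup₂ (f := fun (r : ℝ) (_ : 0 < r) => ENNReal.ofReal (⨍ y in ball x r, |f y|)) r hr

theorem centeredMaximal_le_ofReal_iff {n : ℕ} {f : EuclideanSpace ℝ (Fin n) → ℝ}
    (hf : LocallyIntegrable f volume)
    (h0 : ∀ᵐ x ∂(volume : Measure (EuclideanSpace ℝ (Fin n))), 0 ≤ f x)
    {x : EuclideanSpace ℝ (Fin n)} (hx : 0 ≤ f x) :
    centeredMaximal f x ≤ ENNReal.ofReal (f x) ↔
      ∀ r : ℝ, 0 < r → ⨍ y in ball x r, f y ≤ f x := by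
  have h (r : ℝ) : ⨍ y in ball x r, |f y| = ⨍ y in ball x r, f y :=
    setAverage_congr_fun measurableSet_ball (h0.mono fun y hy _ => abs_of_nonneg hy)
  simp only [centeredMaximal_eq_iSup_ofReal_setAverage hf, iSup_le_iff, h,
    ENNReal.ofReal_le_ofReal_iff hx]

theorem statement0 (n : ℕ) (hn : 1 ≤ n) (f : EuclideanSpace ℝ (Fin n) → ℝ)
    (hf : LocallyIntegrable f volume) :
    (∀ᵐ x ∂(volume : Measure (EuclideanSpace ℝ (Fin n))),
        centeredMaximal f x = ENNReal.ofReal (f x)) ↔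
      ((∀ᵐ x ∂(volume : Measure (EuclideanSpace ℝ (Fin n))), 0 ≤ f x) ∧
        ∀ᵐ x ∂(volume : Measure (EuclideanSpace ℝ (Fin n))),
          ∀ r : ℝ, 0 < r → ⨍ y in ball x r, f y ≤ f x) := by
  have hle := ae_ofReal_abs_le_centeredMaximal hf
  constructor
  · intro h
    have h0 : ∀ᵐ x ∂(volume : Measure (EuclideanSpace ℝ (Fin n))), 0 ≤ f x := by
      filter_upwards [h, hle] with x hx hlex
      by_contra! hneg
      rw [hx, ENNReal.ofReal_of_nonpos hneg.le, nonpos_iff_eq_zero, ENNReal.ofReal_eq_zero] at hlex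
      exact hneg.ne (abs_nonpos_iff.1 hlex)
    refine ⟨h0, ?_⟩
    filter_upwards [h, h0] with x hx hx0
    exact (centeredMaximal_le_ofReal_iff hf h0 hx0).1 hx.le
  · rintro ⟨h0, h⟩
    filter_upwards [h0, h, hle] with x hx0 hx hlex
    refine le_antisymm ((centeredMaximal_le_ofReal_iff hf h0 hx0).2 hx) ?_
    rwa [abs_of_nonneg hx0] at hlex
end

section
/- Let n ≥ 1, let f ∈ L¹_loc(ℝⁿ) be nonnegative with Mf = f almost everywhere, and let φ : ℝⁿ → ℝ be a nonnegative C^∞ function with compact support and ∫_{ℝⁿ} φ(x) dx = 1. For t > 0 set φ_t(x) = t^{-n} φ(x/t). Then the convolution g = f ∗ φ_t satisfies Mg(x) = g(x) for every x ∈ ℝⁿ, and g is C^∞. -/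
open MeasureTheory Metric ENNReal

theorem setLIntegral_ball_le_of_centeredMaximal_le {n : ℕ} {f : EuclideanSpace ℝ (Fin n) → ℝ}
    (hf0 : ∀ x, 0 ≤ f x) {x : EuclideanSpace ℝ (Fin n)}
    (hx : centeredMaximal f x ≤ ENNReal.ofReal (f x)) {r : ℝ} (hr : 0 < r) :
    ∫⁻ y in ball x r, ENNReal.ofReal (f y) ≤ ENNReal.ofReal (f x) * volume (ball x r) := by
  have h : (∫⁻ y in ball x r, ENNReal.ofReal |f y|) / volume (ball x r)
      ≤ ENNReal.ofReal (f x) :=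
    le_trans (le_iSup₂_of_le (f := fun (r : ℝ) (_ : 0 < r) =>
      (∫⁻ y in ball x r, ENNReal.ofReal |f y|) / volume (ball x r)) r hr le_rfl) hx
  simp only [abs_of_nonneg (hf0 _)] at h
  rwa [ENNReal.div_le_iff (measure_ball_pos volume x hr).ne' measure_ball_lt_top.ne] at h

theorem ofReal_le_centeredMaximal {n : ℕ} {g : EuclideanSpace ℝ (Fin n) → ℝ}
    (hg : Continuous g) (x : EuclideanSpace ℝ (Fin n)) :
    ENNReal.ofReal (g x) ≤ centeredMaximal g x := by
  refine le_of_forall_lt fun c hc => ?_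
  obtain ⟨d, hcd, hd⟩ := exists_between hc
  obtain ⟨r, hr, hball⟩ := Metric.isOpen_iff.1
    (isOpen_lt continuous_const (ENNReal.continuous_ofReal.comp hg)) x hd
  refine hcd.trans_le (le_iSup₂_of_le r hr ?_)
  rw [ENNReal.le_div_iff_mul_le (.inl (measure_ball_pos volume x hr).ne')
    (.inl measure_ball_lt_top.ne), ← setLIntegral_const]
  exact setLIntegral_mono' measurableSet_ball fun y hy =>
    (hball hy).le.trans (ENNReal.ofReal_le_ofReal (le_abs_self _))

theorem setLIntegral_ball_sub_right {n : ℕ} (F : EuclideanSpace ℝ (Fin n) → ℝ≥0∞)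
    (x z : EuclideanSpace ℝ (Fin n)) (r : ℝ) :
    ∫⁻ y in ball x r, F (y - z) = ∫⁻ w in ball (x - z) r, F w := by
  rw [← lintegral_indicator measurableSet_ball, ← lintegral_indicator measurableSet_ball,
    ← lintegral_sub_right_eq_self ((ball (x - z) r).indicator F) z]
  refine lintegral_congr fun y => ?_
  simp [Set.indicator, mem_ball]

theorem integrable_sub_left_mul {n : ℕ} {f ψ : EuclideanSpace ℝ (Fin n) → ℝ}
    (hf : LocallyIntegrable f volume) (hψ : Continuous ψ) (hψsupp : HasCompactSupport ψ)
    (x : EuclideanSpace ℝ (Fin n)) : Integrable (fun y => f (x - y) * ψ y) volume := by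
  have h := hψsupp.convolutionExists_right (ContinuousLinearMap.mul ℝ ℝ) hf hψ x
  simpa using h.integrable.comp_sub_left x

theorem setLIntegral_ball_convolution_le {n : ℕ} {f ψ : EuclideanSpace ℝ (Fin n) → ℝ}
    (hf : LocallyIntegrable f volume) (hf0 : ∀ x, 0 ≤ f x)
    (hfix : ∀ᵐ x ∂(volume : Measure (EuclideanSpace ℝ (Fin n))),
      centeredMaximal f x ≤ ENNReal.ofReal (f x))
    (hψ0 : ∀ x, 0 ≤ ψ x) (hψ : Continuous ψ) (hψsupp : HasCompactSupport ψ)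
    (x : EuclideanSpace ℝ (Fin n)) {r : ℝ} (hr : 0 < r) :
    ∫⁻ y in ball x r, ENNReal.ofReal (∫ z, f (y - z) * ψ z)
      ≤ ENNReal.ofReal (∫ z, f (x - z) * ψ z) * volume (ball x r) := by
  have hconv : ∀ y, ENNReal.ofReal (∫ z, f (y - z) * ψ z)
      = ∫⁻ z, ENNReal.ofReal (f (y - z)) * ENNReal.ofReal (ψ z) := fun y => by
    rw [ofReal_integral_eq_lintegral_ofReal (integrable_sub_left_mul hf hψ hψsupp y)
      (.of_forall fun z => mul_nonneg (hf0 _) (hψ0 _))]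
    simp only [ENNReal.ofReal_mul (hf0 _)]
  have hF : AEMeasurable (fun y => ENNReal.ofReal (f y)) volume :=
    hf.aestronglyMeasurable.aemeasurable.ennreal_ofReal
  have hΨ : Measurable fun z => ENNReal.ofReal (ψ z) := hψ.measurable.ennreal_ofReal
  have hprod : AEMeasurable (Function.uncurry fun y z =>
      ENNReal.ofReal (f (y - z)) * ENNReal.ofReal (ψ z))
      ((volume.restrict (ball x r)).prod volume) := by
    refine AEMeasurable.mono_ac (ν := volume.prod volume) ?_
      (Measure.restrict_le_self.absolutelyContinuous.prod .rfl)
    exact (hF.comp_quasiMeasurePreserving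
      (quasiMeasurePreserving_sub_of_right_invariant volume volume)).mul
        (hΨ.comp measurable_snd).aemeasurable
  simp only [hconv]
  rw [lintegral_lintegral_swap hprod, ← lintegral_mul_const' _ _ measure_ball_lt_top.ne]
  refine lintegral_mono_ae ?_
  filter_upwards [(quasiMeasurePreserving_sub_left_of_right_invariant volume x).ae hfix]
    with z hz
  rw [lintegral_mul_const' _ _ ENNReal.ofReal_ne_top,
    setLIntegral_ball_sub_right (fun w => ENNReal.ofReal (f w)), mul_right_comm]
  gcongr
  refine (setLIntegral_ball_le_of_centeredMaximal_le hf0 hz hr).trans_eq ?_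
  simp only [Measure.addHaar_ball_center]

theorem statement1 (n : ℕ) (hn : 1 ≤ n) (f φ : EuclideanSpace ℝ (Fin n) → ℝ)
    (hf : LocallyIntegrable f volume) (hf0 : ∀ x, 0 ≤ f x)
    (hfix : ∀ᵐ x ∂(volume : Measure (EuclideanSpace ℝ (Fin n))),
      centeredMaximal f x = ENNReal.ofReal (f x))
    (hφ0 : ∀ x, 0 ≤ φ x) (hφsmooth : ContDiff ℝ (⊤ : ℕ∞) φ) (hφsupp : HasCompactSupport φ)
    (hφint : ∫ x, φ x ∂(volume : Measure (EuclideanSpace ℝ (Fin n))) = 1)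
    (t : ℝ) (ht : 0 < t)
    (g : EuclideanSpace ℝ (Fin n) → ℝ)
    (hg : g = fun x => ∫ y, f (x - y) * ((t ^ n)⁻¹ * φ (t⁻¹ • y)) ∂volume) :
    (∀ x, centeredMaximal g x = ENNReal.ofReal (g x)) ∧ ContDiff ℝ (⊤ : ℕ∞) g := by
  set ψ : EuclideanSpace ℝ (Fin n) → ℝ := fun y => (t ^ n)⁻¹ * φ (t⁻¹ • y)
  have hψ0 : ∀ y, 0 ≤ ψ y := fun y => mul_nonneg (by positivity) (hφ0 _)
  have hψsmooth : ContDiff ℝ (⊤ : ℕ∞) ψ :=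
    contDiff_const.mul (hφsmooth.comp (contDiff_const_smul t⁻¹))
  have hψsupp : HasCompactSupport ψ := (hφsupp.comp_smul (inv_ne_zero ht.ne')).mul_left
  have hgconv : g = convolution f ψ (ContinuousLinearMap.mul ℝ ℝ) volume := by
    rw [hg]
    funext x
    rw [convolution_eq_swap]
    rfl
  have hgsmooth : ContDiff ℝ (⊤ : ℕ∞) g :=
    hgconv ▸ hψsupp.contDiff_convolution_right _ hf hψsmooth
  have hg0 : ∀ x, 0 ≤ g x := fun x => by
    rw [hg]
    exact integral_nonneg fun y => mul_nonneg (hf0 _) (hψ0 _)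
  refine ⟨fun x => le_antisymm (iSup₂_le fun r hr => ENNReal.div_le_of_le_mul ?_)
    (ofReal_le_centeredMaximal hgsmooth.continuous x), hgsmooth⟩
  simp only [abs_of_nonneg (hg0 _)]
  rw [hg]
  exact setLIntegral_ball_convolution_le hf hf0 (hfix.mono fun _ h => h.le) hψ0
    hψsmooth.continuous hψsupp x hr
end

section
/- Let n ≥ 1 and let f ∈ L¹_loc(ℝⁿ) be nonnegative, not almost everywhere zero, and satisfy Mf ≤ f almost everywhere. Then the measure f(x)dx is doubling: there exists a constant C ≥ 1 such that for every x ∈ ℝⁿ and every r > 0, ∫_{B(x,2r)} f(y) dy ≤ C ∫_{B(x,r)} f(y) dy. -/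
open MeasureTheory Metric ENNReal

/-- A function dominating its centered maximal function has mass on `ball x r` controlling its mass
on `ball x (2 * r)`, because `ball x (2 * r) ⊆ ball y (3 * r)` for every `y ∈ ball x r`. -/
theorem lintegral_ball_two_mul_le_of_centeredMaximal_le {n : ℕ}
    {f : EuclideanSpace ℝ (Fin n) → ℝ}
    (hfix : ∀ᵐ x ∂(volume : Measure (EuclideanSpace ℝ (Fin n))),
      centeredMaximal f x ≤ ENNReal.ofReal (f x))
    (x : EuclideanSpace ℝ (Fin n)) {r : ℝ} (hr : 0 < r) :
    ∫⁻ y in ball x (2 * r), ENNReal.ofReal (f y) ≤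
      ENNReal.ofReal (3 ^ n) * ∫⁻ y in ball x r, ENNReal.ofReal (f y) := by
  set I := ∫⁻ y in ball x (2 * r), ENNReal.ofReal (f y)
  set v := volume (ball x r)
  have hv0 : v ≠ 0 := (measure_ball_pos _ _ hr).ne'
  have hvt : v ≠ ∞ := measure_ball_lt_top.ne
  have hvol (y : EuclideanSpace ℝ (Fin n)) :
      volume (ball y (3 * r)) = ENNReal.ofReal (3 ^ n) * v := by
    rw [Measure.addHaar_ball_mul_of_pos volume y (by norm_num : (0 : ℝ) < 3) r,
      finrank_euclideanSpace_fin, ← Measure.addHaar_ball_center volume x r]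
  have hc0 : ENNReal.ofReal ((3 : ℝ) ^ n) ≠ 0 := by simp
  have hpt : ∀ᵐ y, y ∈ ball x r → I / (ENNReal.ofReal (3 ^ n) * v) ≤ ENNReal.ofReal (f y) := by
    filter_upwards [hfix] with y hy hyx
    refine le_trans ?_ hy
    refine le_trans ?_ (le_iSup₂ (3 * r) (by positivity))
    rw [hvol]
    gcongr
    refine (lintegral_mono_set (ball_subset_ball' ?_)).trans
      (lintegral_mono fun z => ENNReal.ofReal_le_ofReal (le_abs_self _))
    have : dist x y < r := mem_ball'.1 hyx
    linarith
  have hint : I / (ENNReal.ofReal (3 ^ n) * v) * v ≤ ∫⁻ y in ball x r, ENNReal.ofReal (f y) := by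
    rw [← setLIntegral_const]
    exact setLIntegral_mono_ae' measurableSet_ball hpt
  calc I = ENNReal.ofReal (3 ^ n) * v * (I / (ENNReal.ofReal (3 ^ n) * v)) :=
        (ENNReal.mul_div_cancel (mul_ne_zero hc0 hv0)
          (ENNReal.mul_ne_top ENNReal.ofReal_ne_top hvt)).symm
    _ = ENNReal.ofReal (3 ^ n) * (I / (ENNReal.ofReal (3 ^ n) * v) * v) := by ring
    _ ≤ _ := by gcongr

theorem statement3 (n : ℕ) (hn : 1 ≤ n) (f : EuclideanSpace ℝ (Fin n) → ℝ)
    (hf : LocallyIntegrable f volume) (hf0 : ∀ x, 0 ≤ f x)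
    (hne : ¬ f =ᵐ[volume] (fun _ => (0 : ℝ)))
    (hfix : ∀ᵐ x ∂(volume : Measure (EuclideanSpace ℝ (Fin n))),
      centeredMaximal f x ≤ ENNReal.ofReal (f x)) :
    ∃ C : ℝ, 1 ≤ C ∧ ∀ (x : EuclideanSpace ℝ (Fin n)) (r : ℝ), 0 < r →
      ∫ y in ball x (2 * r), f y ∂volume ≤ C * ∫ y in ball x r, f y ∂volume := by
  refine ⟨3 ^ n, one_le_pow₀ (by norm_num), fun x r hr => ?_⟩
  have hint (s : ℝ) : IntegrableOn f (ball x s) :=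
    (hf.integrableOn_isCompact (isCompact_closedBall x s)).mono_set ball_subset_closedBall
  have hlint (s : ℝ) : ENNReal.ofReal (∫ y in ball x s, f y) =
      ∫⁻ y in ball x s, ENNReal.ofReal (f y) :=
    ofReal_integral_eq_lintegral_ofReal (hint s) (ae_of_all _ hf0)
  have h0 : 0 ≤ ∫ y in ball x r, f y := integral_nonneg hf0
  rw [← ENNReal.ofReal_le_ofReal_iff (by positivity), ENNReal.ofReal_mul (by positivity),
    hlint, hlint]
  exact lintegral_ball_two_mul_le_of_centeredMaximal_le hfix x hr
end

section
/- Let n ≥ 3 and let f ∈ C^∞(ℝⁿ) be a non-constant function with Mf(x) = f(x) for every x ∈ ℝⁿ. Then there exists a constant c > 0 such that f(x) ≥ c |x|^{2−n} for every x ∈ ℝⁿ with |x| > 1. -/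
open MeasureTheory Metric ENNReal

section Moments

variable {F : Type*} [NormedAddCommGroup F] [InnerProductSpace ℝ F] [FiniteDimensional ℝ F]
  [MeasurableSpace F] [BorelSpace F]

/-- Integrals over centered balls are invariant under linear isometries. -/
theorem setIntegral_ball_comp_isometry (e : F ≃ₗᵢ[ℝ] F) (g : F → ℝ) (r : ℝ) :
    ∫ y in ball (0 : F) r, g (e y) = ∫ y in ball (0 : F) r, g y := by
  have h := e.measurePreserving.setIntegral_preimage_emb
    e.toHomeomorph.measurableEmbedding g (ball (0 : F) r)
  have hpre : e ⁻¹' ball (0 : F) r = ball (0 : F) r := by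
    ext y
    simp
  rwa [hpre] at h

/-- The integral of an odd function over a centered ball vanishes. -/
theorem setIntegral_ball_eq_zero_of_odd {g : F → ℝ} (hg : ∀ y, g (-y) = -g y) (r : ℝ) :
    ∫ y in ball (0 : F) r, g y = 0 := by
  have h := setIntegral_ball_comp_isometry (LinearIsometryEquiv.neg ℝ) g r
  simp only [LinearIsometryEquiv.coe_neg, hg, integral_neg] at h
  linarith

theorem integrableOn_ball_of_continuous {g : F → ℝ} (hg : Continuous g) (x : F) (r : ℝ) :
    IntegrableOn g (ball x r) :=
  (hg.continuousOn.integrableOn_compact (isCompact_closedBall x r)).mono_set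
    ball_subset_closedBall

theorem setIntegral_ball_inner_sq_congr {v w : F} (h : ‖v‖ = ‖w‖) (r : ℝ) :
    ∫ y in ball (0 : F) r, inner ℝ v y ^ 2 = ∫ y in ball (0 : F) r, inner ℝ w y ^ 2 := by
  set e := (ℝ ∙ (v - w))ᗮ.reflection
  have he : e v = w := Submodule.reflection_sub h
  rw [← setIntegral_ball_comp_isometry e (fun y => inner ℝ w y ^ 2) r]
  simp only [← he, LinearIsometryEquiv.inner_map_map]

/-- The second moments of a centered ball are isotropic. -/
theorem finrank_mul_setIntegral_ball_inner_sq (v : F) (r : ℝ) :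
    (Module.finrank ℝ F : ℝ) * ∫ y in ball (0 : F) r, inner ℝ v y ^ 2 =
      ‖v‖ ^ 2 * ∫ y in ball (0 : F) r, ‖y‖ ^ 2 := by
  let b := stdOrthonormalBasis ℝ F
  have h (i) : ∫ y in ball (0 : F) r, inner ℝ v y ^ 2 =
      ‖v‖ ^ 2 * ∫ y in ball (0 : F) r, inner ℝ (b i) y ^ 2 := by
    rw [← integral_const_mul]
    have hn : ‖v‖ = ‖‖v‖ • b i‖ := by simp [norm_smul]
    rw [setIntegral_ball_inner_sq_congr hn]
    simp only [real_inner_smul_left, mul_pow]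
  calc (Module.finrank ℝ F : ℝ) * ∫ y in ball (0 : F) r, inner ℝ v y ^ 2
      = ∑ i, ‖v‖ ^ 2 * ∫ y in ball (0 : F) r, inner ℝ (b i) y ^ 2 := by
        simp only [← h]
        simp
    _ = ‖v‖ ^ 2 * ∫ y in ball (0 : F) r, ∑ i, inner ℝ (b i) y ^ 2 := by
        rw [integral_finsetSum, Finset.mul_sum]
        intro i _
        exact integrableOn_ball_of_continuous (by fun_prop) 0 r
    _ = _ := by
        simp only [OrthonormalBasis.sum_sq_inner_right]

theorem setIntegral_ball_norm_sq_pos [Nontrivial F] {r : ℝ} (hr : 0 < r) :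
    0 < ∫ y in ball (0 : F) r, ‖y‖ ^ 2 := by
  rw [setIntegral_pos_iff_support_of_nonneg_ae (ae_of_all _ fun y => sq_nonneg ‖y‖)
    (integrableOn_ball_of_continuous (by fun_prop) 0 r)]
  have hs : (Function.support fun y : F => ‖y‖ ^ 2) = {0}ᶜ := by
    ext y
    simp
  rw [hs, Set.inter_comm, ← Set.sdiff_eq, measure_sdiff_null (measure_singleton _)]
  exact measure_ball_pos _ _ hr

end Moments

theorem eventually_quadratic_le_rpow_neg {a b : ℝ} (hb : b < a * (a + 1) / 2) :
    ∀ᶠ t in nhds (0 : ℝ), 1 - a * t + b * t ^ 2 ≤ (1 + t) ^ (-a) := by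
  let ψ : ℝ → ℝ := fun t => (1 + t) ^ (-a) - (1 - a * t + b * t ^ 2)
  have hne : ∀ᶠ t in nhds (0 : ℝ), 1 + t ≠ 0 :=
    ContinuousAt.eventually_ne (by fun_prop) (by norm_num)
  have hrpow {p t : ℝ} (ht : 1 + t ≠ 0) :
      HasDerivAt (fun u : ℝ => (1 + u) ^ p) (p * (1 + t) ^ (p - 1)) t := by
    have h1 := ((hasDerivAt_id t).const_add 1).rpow_const (p := p) (Or.inl ht)
    simpa using h1
  have hd {t : ℝ} (ht : 1 + t ≠ 0) :
      HasDerivAt ψ (-a * (1 + t) ^ (-a - 1) - (-a + 2 * b * t)) t := by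
    refine (hrpow ht).sub ?_
    have h2 : HasDerivAt (fun t : ℝ => 1 - a * t + b * t ^ 2)
        (-(a * 1) + b * (2 * t)) t := by
      convert! (((hasDerivAt_id t).const_mul a).const_sub 1).add
        ((hasDerivAt_pow 2 t).const_mul b) using 1
      simp
    convert! h2 using 1
    ring
  have hderiv : deriv ψ =ᶠ[nhds 0]
      fun t => -a * (1 + t) ^ (-a - 1) - (-a + 2 * b * t) := by
    filter_upwards [hne] with t ht using (hd ht).deriv
  have hd2 : HasDerivAt (fun t : ℝ => -a * (1 + t) ^ (-a - 1) - (-a + 2 * b * t))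
      (a * (a + 1) - 2 * b) 0 := by
    have h1 := (hrpow (p := -a - 1) (t := 0) (by norm_num)).const_mul (-a)
    have h2 := ((hasDerivAt_id (0 : ℝ)).const_mul (2 * b)).const_add (-a)
    convert! h1.sub h2 using 1
    simp
    ring
  have hmin : IsLocalMin ψ 0 := by
    refine isLocalMin_of_deriv_deriv_pos ?_ ?_ (hd (by norm_num)).continuousAt
    · rw [hderiv.deriv_eq, hd2.deriv]
      linarith
    · rw [(hd (by norm_num)).deriv]
      simp
  filter_upwards [hmin] with t ht
  simp only [ψ] at ht
  norm_num at ht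
  linarith

section Comparison

variable {F : Type*} [NormedAddCommGroup F] [InnerProductSpace ℝ F] [FiniteDimensional ℝ F]
  [MeasurableSpace F] [BorelSpace F]

/-- Away from the origin, `‖x‖ ^ (-s)` with `s > max (n - 2) 0` is strictly subharmonic: near
each point it lies above a continuous function whose averages over small balls exceed its value
at that point. -/
theorem exists_subharmonic_minorant_norm_rpow_neg [Nontrivial F] {s : ℝ} (hs : 0 < s)
    (hs' : (Module.finrank ℝ F : ℝ) - 2 < s) {x : F} (hx : x ≠ 0) :
    ∃ Q : F → ℝ, Continuous Q ∧
      (∀ᶠ y in nhds (0 : F), Q y ≤ ‖x + y‖ ^ (-s) - ‖x‖ ^ (-s)) ∧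
      ∀ r, 0 < r → 0 < ∫ y in ball (0 : F) r, Q y := by
  set N : ℝ := (Module.finrank ℝ F : ℝ)
  have hN : 0 < N := by
    simp only [N]
    exact_mod_cast Module.finrank_pos
  obtain ⟨a, ha, hsa⟩ : ∃ a, 0 < a ∧ s = 2 * a := ⟨s / 2, by linarith, by ring⟩
  obtain ⟨b, hb1, hb2⟩ : ∃ b, a * N / 4 < b ∧ b < a * (a + 1) / 2 :=
    exists_between (by nlinarith)
  have hb : 0 < b := lt_trans (by positivity) hb1
  have hρ : 0 < ‖x‖ := norm_pos_iff.mpr hx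
  let τ : F → ℝ := fun y => (2 * inner ℝ x y + ‖y‖ ^ 2) / ‖x‖ ^ 2
  have hτc : Continuous τ := by fun_prop
  have hτ0 : τ 0 = 0 := by simp [τ]
  have hτ (y : F) : ‖x + y‖ ^ (-s) = ‖x‖ ^ (-s) * (1 + τ y) ^ (-a) := by
    have h1 : 1 + τ y = (‖x + y‖ / ‖x‖) ^ 2 := by
      simp only [τ]
      rw [div_pow, norm_add_sq_real]
      field_simp
      ring
    rw [h1, ← Real.rpow_natCast, ← Real.rpow_mul (by positivity),
      Real.div_rpow (by positivity) (by positivity), hsa]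
    push_cast
    rw [show (2 : ℝ) * -a = -(2 * a) by ring]
    have : ‖x‖ ^ (-(2 * a)) ≠ 0 := (Real.rpow_pos_of_pos hρ _).ne'
    field_simp
  refine ⟨fun y => ‖x‖ ^ (-s) * (-a * τ y + b * τ y ^ 2), by fun_prop, ?_, fun r hr => ?_⟩
  · have h := (hτc.tendsto' 0 0 hτ0).eventually (eventually_quadratic_le_rpow_neg hb2)
    filter_upwards [h] with y hy
    rw [hτ]
    have := mul_le_mul_of_nonneg_left hy (Real.rpow_nonneg hρ.le (-s))
    linarith
  · rw [integral_const_mul]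
    refine mul_pos (Real.rpow_pos_of_pos hρ _) ?_
    let odd : F → ℝ := fun y =>
      -2 * a / ‖x‖ ^ 2 * inner ℝ x y + 4 * b / ‖x‖ ^ 4 * (inner ℝ x y * ‖y‖ ^ 2)
    let even : F → ℝ := fun y =>
      4 * b / ‖x‖ ^ 4 * inner ℝ x y ^ 2 - a / ‖x‖ ^ 2 * ‖y‖ ^ 2
    let quartic : F → ℝ := fun y => b / ‖x‖ ^ 4 * ‖y‖ ^ 4
    have hsplit (y : F) : -a * τ y + b * τ y ^ 2 = odd y + even y + quartic y := by
      simp only [τ, odd, even, quartic]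
      field_simp
      ring
    have hi {g : F → ℝ} (hg : Continuous g) :
        Integrable g (volume.restrict (ball (0 : F) r)) :=
      integrableOn_ball_of_continuous hg 0 r
    have hodd : ∫ y in ball (0 : F) r, odd y = 0 :=
      setIntegral_ball_eq_zero_of_odd (fun y => by simp [odd]; ring) r
    have hquartic : 0 ≤ ∫ y in ball (0 : F) r, quartic y :=
      integral_nonneg fun y => by simp only [quartic, Pi.zero_apply]; positivity
    have heven : 0 < ∫ y in ball (0 : F) r, even y := by
      simp only [even]
      rw [integral_sub (hi (by fun_prop)) (hi (by fun_prop)), integral_const_mul,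
        integral_const_mul]
      have hm := finrank_mul_setIntegral_ball_inner_sq x r
      have hp := setIntegral_ball_norm_sq_pos (F := F) hr
      set I := ∫ y in ball (0 : F) r, inner ℝ x y ^ 2
      set J := ∫ y in ball (0 : F) r, ‖y‖ ^ 2
      have hI : I = ‖x‖ ^ 2 * J / N := by
        rw [eq_div_iff hN.ne', ← hm]
        exact mul_comm _ _
      have : 4 * b / ‖x‖ ^ 4 * I - a / ‖x‖ ^ 2 * J = (4 * b - a * N) * (J / (N * ‖x‖ ^ 2)) := by
        rw [hI]
        field_simp
      rw [this]
      exact mul_pos (by linarith) (by positivity)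
    simp only [hsplit]
    rw [integral_add (hi (by fun_prop)) (hi (by fun_prop)),
      integral_add (hi (by fun_prop)) (hi (by fun_prop))]
    linarith

/-- A function satisfying the super-mean-value inequality, minus a multiple of `‖x‖ ^ (-s)`, has
no local minimum away from the origin. -/
theorem not_isLocalMin_sub_norm_rpow_neg [Nontrivial F] {f : F → ℝ} (hf : Continuous f)
    (hmean : ∀ x r, 0 < r → ∫ y in ball (0 : F) r, (f (x + y) - f x) ≤ 0)
    {s c : ℝ} (hs : 0 < s) (hs' : (Module.finrank ℝ F : ℝ) - 2 < s) (hc : 0 < c)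
    {x : F} (hx : x ≠ 0) : ¬ IsLocalMin (fun z => f z - c * ‖z‖ ^ (-s)) x := by
  intro hmin
  obtain ⟨Q, hQc, hQ, hQi⟩ := exists_subharmonic_minorant_norm_rpow_neg hs hs' hx
  have hshift : Filter.Tendsto (fun y : F => x + y) (nhds 0) (nhds x) :=
    (continuous_const.add continuous_id).tendsto' 0 x (by simp)
  obtain ⟨r, hr, hball⟩ := Metric.eventually_nhds_iff_ball.mp
    (hQ.and (hshift.eventually hmin))
  have hle : ∫ y in ball (0 : F) r, c * Q y ≤ ∫ y in ball (0 : F) r, (f (x + y) - f x) := by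
    refine setIntegral_mono_on (integrableOn_ball_of_continuous (by fun_prop) 0 r)
      (integrableOn_ball_of_continuous (by fun_prop) 0 r) measurableSet_ball fun y hy => ?_
    obtain ⟨h1, h2⟩ := hball y hy
    have := mul_le_mul_of_nonneg_left h1 hc.le
    linarith
  rw [integral_const_mul] at hle
  have := mul_pos hc (hQi r hr)
  linarith [hmean x r hr]

theorem norm_rpow_neg_le_of_superharmonic [Nontrivial F] {f : F → ℝ} (hf : Continuous f)
    (hmean : ∀ x r, 0 < r → ∫ y in ball (0 : F) r, (f (x + y) - f x) ≤ 0)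
    (hpos : ∀ x, 0 ≤ f x) {s c : ℝ} (hs : 0 < s) (hs' : (Module.finrank ℝ F : ℝ) - 2 < s)
    (hc : 0 < c) (hsphere : ∀ x, ‖x‖ = 1 → c ≤ f x) {x : F} (hx : 1 < ‖x‖) :
    c * ‖x‖ ^ (-s) ≤ f x := by
  have key (R : ℝ) (hR : ‖x‖ < R) : c * ‖x‖ ^ (-s) - c * R ^ (-s) ≤ f x := by
    let K : Set F := closedBall 0 R ∩ {z | 1 ≤ ‖z‖}
    have hK : IsCompact K :=
      (isCompact_closedBall 0 R).inter_right (isClosed_le continuous_const continuous_norm)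
    have hxK : x ∈ K := ⟨by simpa using hR.le, hx.le⟩
    have hcont : ContinuousOn (fun z => f z - c * ‖z‖ ^ (-s)) K := by
      refine hf.continuousOn.sub (continuousOn_const.mul ?_)
      refine continuous_norm.continuousOn.rpow_const fun z hz => Or.inl ?_
      exact (zero_lt_one.trans_le hz.2).ne'
    obtain ⟨z, hzK, hz⟩ := hK.exists_isMinOn ⟨x, hxK⟩ hcont
    have hzx : f z - c * ‖z‖ ^ (-s) ≤ f x - c * ‖x‖ ^ (-s) := hz hxK
    have hR0 : 0 < R := by linarith
    have hRpos : 0 ≤ c * R ^ (-s) := by positivity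
    have hz1 : 1 ≤ ‖z‖ := hzK.2
    have hzR : ‖z‖ ≤ R := by simpa using hzK.1
    suffices -(c * R ^ (-s)) ≤ f z - c * ‖z‖ ^ (-s) by linarith
    rcases hz1.eq_or_lt with h1 | h1
    · have := hsphere z h1.symm
      rw [← h1, Real.one_rpow]
      linarith
    rcases hzR.eq_or_lt with h2 | h2
    · rw [h2]
      linarith [hpos z]
    exfalso
    refine not_isLocalMin_sub_norm_rpow_neg hf hmean hs hs' hc
      (norm_pos_iff.mp (zero_lt_one.trans h1)) (hz.isLocalMin ?_)
    have ho : IsOpen {w : F | 1 < ‖w‖ ∧ ‖w‖ < R} :=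
      (isOpen_lt continuous_const continuous_norm).inter
        (isOpen_lt continuous_norm continuous_const)
    filter_upwards [ho.mem_nhds ⟨h1, h2⟩] with w hw
    exact ⟨by simpa using hw.2.le, hw.1.le⟩
  have hlim : Filter.Tendsto (fun R : ℝ => c * ‖x‖ ^ (-s) - c * R ^ (-s)) Filter.atTop
      (nhds (c * ‖x‖ ^ (-s) - c * 0)) :=
    tendsto_const_nhds.sub ((tendsto_rpow_neg_atTop hs).const_mul c)
  rw [mul_zero, sub_zero] at hlim
  exact le_of_tendsto hlim ((Filter.eventually_gt_atTop ‖x‖).mono key)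

end Comparison

theorem lintegral_ball_le_centeredMaximal_mul {n : ℕ} (f : EuclideanSpace ℝ (Fin n) → ℝ)
    (x : EuclideanSpace ℝ (Fin n)) {r : ℝ} (hr : 0 < r) :
    ∫⁻ y in ball x r, ENNReal.ofReal |f y| ≤ centeredMaximal f x * volume (ball x r) := by
  rw [← ENNReal.div_le_iff (measure_ball_pos volume x hr).ne' measure_ball_lt_top.ne]
  exact le_iSup₂_of_le r hr le_rfl

theorem eq_zero_of_centeredMaximal_eq_zero {n : ℕ} {f : EuclideanSpace ℝ (Fin n) → ℝ}
    (hf : Continuous f) {x : EuclideanSpace ℝ (Fin n)} (h : centeredMaximal f x = 0)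
    (y : EuclideanSpace ℝ (Fin n)) : f y = 0 := by
  have hr : 0 < dist y x + 1 := by positivity
  have h0 := lintegral_ball_le_centeredMaximal_mul f x hr
  rw [h, zero_mul, nonpos_iff_eq_zero, lintegral_eq_zero_iff (by fun_prop)] at h0
  have h1 : f =ᵐ[volume.restrict (ball x (dist y x + 1))] fun _ => 0 := by
    filter_upwards [h0] with z hz
    simpa using hz
  exact Measure.eqOn_open_of_ae_eq h1 isOpen_ball hf.continuousOn continuousOn_const
    (by simp [mem_ball])

theorem setIntegral_sub_nonpos_of_centeredMaximal_le {n : ℕ}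
    {f : EuclideanSpace ℝ (Fin n) → ℝ} (hf : Continuous f) (hpos : ∀ x, 0 ≤ f x)
    {x : EuclideanSpace ℝ (Fin n)} (h : centeredMaximal f x ≤ ENNReal.ofReal (f x))
    {r : ℝ} (hr : 0 < r) :
    ∫ y in ball (0 : EuclideanSpace ℝ (Fin n)) r, (f (x + y) - f x) ≤ 0 := by
  have h1 := (lintegral_ball_le_centeredMaximal_mul f x hr).trans (mul_le_mul_left h _)
  simp only [abs_of_nonneg (hpos _)] at h1
  rw [← ofReal_integral_eq_lintegral_ofReal (integrableOn_ball_of_continuous hf x r)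
    (ae_of_all _ hpos), ← ENNReal.ofReal_toReal (a := volume (ball x r)) measure_ball_lt_top.ne,
    ← ENNReal.ofReal_mul (hpos x), ENNReal.ofReal_le_ofReal_iff
      (mul_nonneg (hpos x) ENNReal.toReal_nonneg)] at h1
  have hshift := (measurePreserving_add_left volume x).setIntegral_preimage_emb
    (measurableEmbedding_addLeft x) (fun z => f z - f x) (ball x r)
  rw [preimage_add_ball, sub_self] at hshift
  rw [hshift, integral_sub (integrableOn_ball_of_continuous hf x r)
    (integrableOn_ball_of_continuous continuous_const x r), setIntegral_const, smul_eq_mul,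
    Measure.real]
  linarith

theorem statement6 (n : ℕ) (hn : 3 ≤ n) (f : EuclideanSpace ℝ (Fin n) → ℝ)
    (hsmooth : ContDiff ℝ (⊤ : ℕ∞) f) (hnc : ¬ ∃ c : ℝ, ∀ x, f x = c)
    (hfix : ∀ x, centeredMaximal f x = ENNReal.ofReal (f x)) :
    ∃ c : ℝ, 0 < c ∧ ∀ x : EuclideanSpace ℝ (Fin n), 1 < ‖x‖ →
      c * ‖x‖ ^ ((2 : ℝ) - n) ≤ f x := by
  have hf : Continuous f := hsmooth.continuous
  have hpos (x) : 0 < f x := by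
    by_contra! hx
    exact hnc ⟨0, eq_zero_of_centeredMaximal_eq_zero hf
      ((hfix x).trans (ENNReal.ofReal_eq_zero.mpr hx))⟩
  have : Nonempty (Fin n) := ⟨⟨0, by omega⟩⟩
  have : Nontrivial (EuclideanSpace ℝ (Fin n)) := inferInstance
  obtain ⟨z, -, hz⟩ := (isCompact_sphere (0 : EuclideanSpace ℝ (Fin n)) 1).exists_isMinOn
    (NormedSpace.sphere_nonempty.mpr zero_le_one) hf.continuousOn
  refine ⟨f z, hpos z, fun x hx => ?_⟩
  have hn' : (3 : ℝ) ≤ n := by exact_mod_cast hn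
  have key (s : ℝ) (hs : (n : ℝ) - 2 < s) : f z * ‖x‖ ^ (-s) ≤ f x :=
    norm_rpow_neg_le_of_superharmonic hf
      (fun x r hr => setIntegral_sub_nonpos_of_centeredMaximal_le hf (fun x => (hpos x).le)
        (hfix x).le hr)
      (fun x => (hpos x).le) (by linarith) (by simpa using hs) (hpos z)
      (fun w hw => hz (by simpa using hw)) hx
  have hcont : Continuous fun s : ℝ => f z * ‖x‖ ^ (-s) :=
    continuous_const.mul ((Real.continuous_const_rpow (by positivity)).comp continuous_neg)
  have hlim := (hcont.tendsto ((n : ℝ) - 2)).mono_left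
    (nhdsWithin_le_nhds (s := Set.Ioi ((n : ℝ) - 2)))
  have hle := le_of_tendsto hlim (eventually_nhdsWithin_of_forall key)
  rwa [neg_sub] at hle
end

section
/- Let n ≥ 1 and define the non-centered Hardy–Littlewood maximal operator by M_nc f(x) = sup { (1/|B|) ∫_B |f(y)| dy : B an open Euclidean ball with x ∈ B }. If f ∈ L¹_loc(ℝⁿ) satisfies M_nc f = f almost everywhere, then f is almost everywhere equal to a constant; i.e., the non-centered maximal operator has only constant fixed points, in every dimension. -/
open MeasureTheory Metric ENNReal

/-- The non-centered Hardy–Littlewood maximal operator on `ℝⁿ`: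
the supremum of averages of `|f|` over all open balls containing `x`. -/
noncomputable def noncenteredMaximal {n : ℕ} (f : EuclideanSpace ℝ (Fin n) → ℝ)
    (x : EuclideanSpace ℝ (Fin n)) : ℝ≥0∞ :=
  ⨆ (c : EuclideanSpace ℝ (Fin n)) (r : ℝ) (_ : 0 < r) (_ : x ∈ ball c r),
    (∫⁻ y in ball c r, ENNReal.ofReal |f y| ∂volume) / volume (ball c r)

theorem average_ball_le_noncenteredMaximal {n : ℕ} (f : EuclideanSpace ℝ (Fin n) → ℝ)
    {x c : EuclideanSpace ℝ (Fin n)} {r : ℝ} (hx : x ∈ ball c r) :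
    (∫⁻ y in ball c r, ENNReal.ofReal |f y| ∂volume) / volume (ball c r) ≤
      noncenteredMaximal f x :=
  le_iSup₂_of_le c r (le_iSup₂_of_le (pos_of_mem_ball hx) hx le_rfl)

/-- A fixed point of the non-centered maximal operator equals its average a.e. on every ball. -/
theorem ae_ball_eq_average_of_noncenteredMaximal_eq {n : ℕ} {f : EuclideanSpace ℝ (Fin n) → ℝ}
    (hf : LocallyIntegrable f volume)
    (hfix : ∀ᵐ x ∂(volume : Measure (EuclideanSpace ℝ (Fin n))),
      noncenteredMaximal f x = ENNReal.ofReal (f x))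
    (c : EuclideanSpace ℝ (Fin n)) {r : ℝ} (hr : 0 < r) :
    ∀ᵐ x ∂(volume : Measure (EuclideanSpace ℝ (Fin n))), x ∈ ball c r →
      f x = ((∫⁻ y in ball c r, ENNReal.ofReal |f y| ∂volume) / volume (ball c r)).toReal := by
  set A := (∫⁻ y in ball c r, ENNReal.ofReal |f y| ∂volume) / volume (ball c r) with hA
  have hint : IntegrableOn f (ball c r) :=
    (hf.integrableOn_isCompact (isCompact_closedBall c r)).mono_set ball_subset_closedBall
  have hfin : ∫⁻ y in ball c r, ENNReal.ofReal |f y| ∂volume ≠ ∞ := by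
    simpa only [← Real.norm_eq_abs, ofReal_norm] using hint.2.ne
  have hvol0 : volume (ball c r) ≠ 0 := (measure_ball_pos volume c hr).ne'
  have hconst : ∫⁻ _ in ball c r, A ∂volume = ∫⁻ y in ball c r, ENNReal.ofReal |f y| ∂volume := by
    rw [setLIntegral_const, hA, ENNReal.div_mul_cancel hvol0 measure_ball_lt_top.ne]
  have hle : ∀ᵐ x ∂volume.restrict (ball c r), A ≤ ENNReal.ofReal (f x) := by
    rw [ae_restrict_iff' measurableSet_ball]
    filter_upwards [hfix] with x hx hxB
    exact hx ▸ average_ball_le_noncenteredMaximal f hxB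
  have hle_abs : ∀ᵐ x ∂volume.restrict (ball c r), A ≤ ENNReal.ofReal |f x| :=
    hle.mono fun x hx => hx.trans (ENNReal.ofReal_le_ofReal (le_abs_self _))
  have heq := ae_eq_of_ae_le_of_lintegral_le hle_abs (hconst ▸ hfin)
    hint.aestronglyMeasurable.aemeasurable.abs.ennreal_ofReal hconst.ge
  rw [← ae_restrict_iff' measurableSet_ball]
  filter_upwards [hle, heq] with x hx hxA
  have hnonneg : 0 ≤ f x := by
    by_contra! hneg
    rw [hxA, ENNReal.ofReal_of_nonpos hneg.le, nonpos_iff_eq_zero, ENNReal.ofReal_eq_zero] at hx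
    exact (abs_pos.mpr hneg.ne).not_ge hx
  rw [hxA, ENNReal.toReal_ofReal (abs_nonneg _), abs_of_nonneg hnonneg]

theorem statement16 (n : ℕ) (hn : 1 ≤ n) (f : EuclideanSpace ℝ (Fin n) → ℝ)
    (hf : LocallyIntegrable f volume)
    (hfix : ∀ᵐ x ∂(volume : Measure (EuclideanSpace ℝ (Fin n))),
      noncenteredMaximal f x = ENNReal.ofReal (f x)) :
    ∃ c : ℝ, f =ᵐ[volume] fun _ => c := by
  have hball := ae_all_iff.2 fun k : ℕ =>
    ae_ball_eq_average_of_noncenteredMaximal_eq hf hfix 0 (Nat.cast_add_one_pos (α := ℝ) k)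
  obtain ⟨x₀, hx₀⟩ := hball.exists
  refine ⟨f x₀, ?_⟩
  filter_upwards [hball] with x hx
  obtain ⟨k, hk⟩ := exists_nat_ge (max ‖x‖ ‖x₀‖)
  rw [hx k (mem_ball_zero_iff.2 (((le_max_left _ _).trans hk).trans_lt (lt_add_one _))),
    hx₀ k (mem_ball_zero_iff.2 (((le_max_right _ _).trans hk).trans_lt (lt_add_one _)))]
end

section
/- Let n ≥ 1 and define the strong maximal operator by M_S f(x) = sup_{r ∈ (0,∞)ⁿ} (1/|R(x,r)|) ∫_{R(x,r)} |f(y)| dy, where R(x,r) = ∏_{i=1}^n [x_i − r_i, x_i + r_i] is the centered axis-parallel rectangle with half-side-lengths r_i. If f ∈ L¹_loc(ℝⁿ) satisfies M_S f = f almost everywhere, then f is almost everywhere equal to a constant; i.e., the strong maximal operator has only constant fixed points, in every dimension. -/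
open MeasureTheory Metric ENNReal

/-- The strong maximal operator on `ℝⁿ`: the supremum of averages of `|f|` over
centered axis-parallel rectangles `R(x,r) = ∏ᵢ [xᵢ - rᵢ, xᵢ + rᵢ]`. -/
noncomputable def strongMaximal {n : ℕ} (f : EuclideanSpace ℝ (Fin n) → ℝ)
    (x : EuclideanSpace ℝ (Fin n)) : ℝ≥0∞ :=
  ⨆ (r : Fin n → ℝ) (_ : ∀ i, 0 < r i),
    (∫⁻ y in {y : EuclideanSpace ℝ (Fin n) | ∀ i, |y i - x i| ≤ r i},
        ENNReal.ofReal |f y| ∂volume) /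
      volume {y : EuclideanSpace ℝ (Fin n) | ∀ i, |y i - x i| ≤ r i}

open scoped Convolution

/-- The coordinatewise scaling `z ↦ (rᵢ zᵢ)ᵢ`. -/
noncomputable def coordScale {n : ℕ} (r : Fin n → ℝ) :
    EuclideanSpace ℝ (Fin n) →ₗ[ℝ] EuclideanSpace ℝ (Fin n) where
  toFun z := WithLp.toLp 2 fun i => r i * z i
  map_add' z w := by ext i; simp [mul_add]
  map_smul' c z := by ext i; simp [mul_left_comm]

@[simp]
theorem coordScale_apply {n : ℕ} (r : Fin n → ℝ) (z : EuclideanSpace ℝ (Fin n)) (i : Fin n) :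
    coordScale r z i = r i * z i := rfl

theorem continuous_coordScale {n : ℕ} :
    Continuous fun p : (Fin n → ℝ) × EuclideanSpace ℝ (Fin n) => coordScale p.1 p.2 := by
  change Continuous fun p : (Fin n → ℝ) × EuclideanSpace ℝ (Fin n) =>
    WithLp.toLp 2 fun i => p.1 i * p.2 i
  fun_prop

theorem det_coordScale_ne_zero {n : ℕ} {r : Fin n → ℝ} (hr : ∀ i, r i ≠ 0) :
    LinearMap.det (coordScale r) ≠ 0 := by
  have h : coordScale r ∘ₗ coordScale (fun i => (r i)⁻¹) = LinearMap.id := by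
    ext z i
    simp [hr i]
  have h2 := congrArg LinearMap.det h
  rw [LinearMap.det_comp, LinearMap.det_id] at h2
  exact left_ne_zero_of_mul_eq_one h2

/-- The cube `[-1, 1]ⁿ`. -/
def unitCube (n : ℕ) : Set (EuclideanSpace ℝ (Fin n)) := {z | ∀ i, |z i| ≤ 1}

theorem isClosed_rectangle {n : ℕ} (x : EuclideanSpace ℝ (Fin n)) (r : Fin n → ℝ) :
    IsClosed {y : EuclideanSpace ℝ (Fin n) | ∀ i, |y i - x i| ≤ r i} := by
  rw [Set.ofPred_forall]
  exact isClosed_iInter fun i => isClosed_le (by fun_prop) continuous_const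

theorem isCompact_rectangle {n : ℕ} (x : EuclideanSpace ℝ (Fin n)) (r : Fin n → ℝ) :
    IsCompact {y : EuclideanSpace ℝ (Fin n) | ∀ i, |y i - x i| ≤ r i} := by
  have h : IsCompact (Set.univ.pi fun i => Set.Icc (x i - r i) (x i + r i)) :=
    isCompact_univ_pi fun i => isCompact_Icc
  have h2 := h.image (PiLp.continuous_toLp 2 fun _ : Fin n => ℝ)
  refine h2.of_isClosed_subset (isClosed_rectangle x r) fun y hy => ⟨WithLp.ofLp y, ?_, rfl⟩
  intro i _
  have := abs_le.1 (hy i)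
  constructor <;> linarith

theorem isCompact_unitCube (n : ℕ) : IsCompact (unitCube n) := by
  simpa [unitCube] using isCompact_rectangle (0 : EuclideanSpace ℝ (Fin n)) fun _ => 1

theorem isOpen_setOf_forall_abs_lt_one (n : ℕ) :
    IsOpen {z : EuclideanSpace ℝ (Fin n) | ∀ i, |z i| < 1} := by
  rw [Set.ofPred_forall]
  exact isOpen_iInter_of_finite fun i => isOpen_lt (by fun_prop) continuous_const

theorem zero_mem_interior_unitCube (n : ℕ) : (0 : EuclideanSpace ℝ (Fin n)) ∈
    interior (unitCube n) :=
  interior_maximal (fun _ hz i => (hz i).le) (isOpen_setOf_forall_abs_lt_one n)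
    (by simp)

theorem convex_unitCube (n : ℕ) : Convex ℝ (unitCube n) := by
  intro z hz w hw a b ha hb hab i
  have h1 := abs_le.1 (hz i)
  have h2 := abs_le.1 (hw i)
  simp only [PiLp.add_apply, PiLp.smul_apply, smul_eq_mul]
  rw [abs_le]
  constructor <;> nlinarith

theorem unitCube_subset_closure_interior (n : ℕ) :
    unitCube n ⊆ closure (interior (unitCube n)) := by
  rw [(convex_unitCube n).closure_interior_eq_closure_of_nonempty_interior
    ⟨0, zero_mem_interior_unitCube n⟩]
  exact subset_closure

theorem volume_unitCube_ne_zero (n : ℕ) : volume (unitCube n) ≠ 0 :=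
  (Measure.measure_pos_of_nonempty_interior _ ⟨0, zero_mem_interior_unitCube n⟩).ne'

theorem setIntegral_unitCube_coord (n : ℕ) (i : Fin n) : ∫ z in unitCube n, z i = 0 := by
  have h := (Measure.measurePreserving_neg
    (volume : Measure (EuclideanSpace ℝ (Fin n)))).setIntegral_preimage_emb
      (MeasurableEquiv.neg _).measurableEmbedding (fun z => z i) (unitCube n)
  have hp : (fun z : EuclideanSpace ℝ (Fin n) => -z) ⁻¹' unitCube n = unitCube n := by
    ext z
    simp [unitCube]
  rw [hp] at h
  simp only [PiLp.neg_apply, integral_neg] at h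
  linarith

/-- Averages over rectangles are rescaled averages over the unit cube. -/
theorem setLIntegral_unitCube_comp_coordScale {n : ℕ} {g : EuclideanSpace ℝ (Fin n) → ℝ≥0∞}
    (hg : Measurable g) {r : Fin n → ℝ} (hr : ∀ i, r i ≠ 0) (x : EuclideanSpace ℝ (Fin n)) :
    ∫⁻ z in unitCube n, g (x + coordScale r z) =
      (∫⁻ y in {y : EuclideanSpace ℝ (Fin n) | ∀ i, |y i - x i| ≤ |r i|}, g y) /
        volume {y : EuclideanSpace ℝ (Fin n) | ∀ i, |y i - x i| ≤ |r i|} *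
          volume (unitCube n) := by
  set B := {y : EuclideanSpace ℝ (Fin n) | ∀ i, |y i - x i| ≤ |r i|} with hB
  have hBm : MeasurableSet B := (isClosed_rectangle x fun i => |r i|).measurableSet
  have hD : Measurable (coordScale r) := (coordScale r).continuous_of_finiteDimensional.measurable
  have hT : Measurable fun z => x + coordScale r z := hD.const_add x
  set c := ENNReal.ofReal |(LinearMap.det (coordScale r))⁻¹| with hc
  have hc0 : c ≠ 0 := by
    simpa [hc] using det_coordScale_ne_zero hr
  have hct : c ≠ ∞ := ofReal_ne_top
  have hmap : Measure.map (fun z => x + coordScale r z) volume = c • volume := by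
    have : (fun z => x + coordScale r z) = (fun y => x + y) ∘ coordScale r := rfl
    rw [this, ← Measure.map_map (measurable_const_add x) hD,
      Measure.map_linearMap_addHaar_eq_smul_addHaar _ (det_coordScale_ne_zero hr),
      Measure.map_smul, map_add_left_eq_self]
  have hpre : (fun z => x + coordScale r z) ⁻¹' B = unitCube n := by
    ext z
    refine forall_congr' fun i => ?_
    simp only [PiLp.add_apply, coordScale_apply, add_sub_cancel_left, abs_mul]
    exact mul_le_iff_le_one_right (abs_pos.2 (hr i))
  have hvol : volume (unitCube n) = c * volume B := by
    rw [← hpre, ← Measure.map_apply hT hBm, hmap]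
    rfl
  have hlin : ∫⁻ z in unitCube n, g (x + coordScale r z) = c * ∫⁻ y in B, g y := by
    rw [← hpre, ← setLIntegral_map hBm hg hT, hmap, Measure.restrict_smul,
      lintegral_smul_measure, smul_eq_mul]
  have hB0 : volume B ≠ 0 := by
    intro h
    exact volume_unitCube_ne_zero n (by rw [hvol, h, mul_zero])
  have hBt : volume B ≠ ∞ := (isCompact_rectangle x fun i => |r i|).measure_lt_top.ne
  rw [hlin, hvol, mul_left_comm, ENNReal.div_mul_cancel hB0 hBt]

/-- Integrals of a continuous function over rescaled cubes depend continuously on the scaling,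
so a mean value inequality for nondegenerate rectangles extends to degenerate ones. -/
theorem setIntegral_unitCube_le_of_forall_ne_zero {n : ℕ} {u : EuclideanSpace ℝ (Fin n) → ℝ}
    (hu : Continuous u) (x : EuclideanSpace ℝ (Fin n)) {C : ℝ}
    (h : ∀ r : Fin n → ℝ, (∀ i, r i ≠ 0) → ∫ z in unitCube n, u (x + coordScale r z) ≤ C)
    (r : Fin n → ℝ) : ∫ z in unitCube n, u (x + coordScale r z) ≤ C := by
  have hcont : Continuous fun r : Fin n → ℝ => ∫ z in unitCube n, u (x + coordScale r z) :=
    continuous_parametric_integral_of_continuous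
      (f := fun (r : Fin n → ℝ) z => u (x + coordScale r z))
      (hu.comp (continuous_const.add continuous_coordScale)) (isCompact_unitCube n)
  have hpath : Continuous fun t : ℝ => fun i => r i + t := by fun_prop
  have hlim : Filter.Tendsto
      (fun t : ℝ => ∫ z in unitCube n, u (x + coordScale (fun i => r i + t) z))
      (nhdsWithin 0 {0}ᶜ) (nhds (∫ z in unitCube n, u (x + coordScale r z))) := by
    have := (hcont.comp hpath).tendsto 0
    simp only [Function.comp_def, add_zero] at this
    exact this.mono_left nhdsWithin_le_nhds
  refine le_of_tendsto hlim ?_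
  have hev : ∀ i, ∀ᶠ t : ℝ in nhdsWithin 0 {0}ᶜ, r i + t ≠ 0 := by
    intro i
    by_cases hi : r i = 0
    · filter_upwards [self_mem_nhdsWithin] with t ht
      simpa [hi] using ht
    · apply Filter.Eventually.filter_mono nhdsWithin_le_nhds
      have hc : Continuous fun t : ℝ => r i + t := by fun_prop
      exact hc.continuousAt.eventually_ne (by simpa using hi)
  filter_upwards [Filter.eventually_all.2 hev] with t ht
  exact h _ ht

/-- A nonnegative continuous function on the line with the super-mean-value property (against the
distribution of a coordinate on the unit cube) satisfies `V 0 ≤ V 1`. -/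
theorem le_of_superMean {n : ℕ} (i : Fin n) {V : ℝ → ℝ} (hV : Continuous V) (h0 : ∀ t, 0 ≤ V t)
    (hmean : ∀ s ρ : ℝ, ∫ z in unitCube n, V (s + ρ * z i) ≤ V s * volume.real (unitCube n)) :
    V 0 ≤ V 1 := by
  by_contra! hlt
  obtain ⟨m, hm⟩ : ∃ m, m = (V 0 - V 1) / 2 := ⟨_, rfl⟩
  have hm0 : 0 < m := by linarith
  set v : ℝ → ℝ := fun t => V t - V 0 + m * t with hv
  have hvc : Continuous v := by fun_prop
  set K : ℝ := V 0 / m + 1 with hK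
  have hmK : m * K = V 0 + m := by rw [hK]; field_simp
  have hK1 : 1 ≤ K := by
    have := div_nonneg (h0 0) hm0.le
    linarith
  obtain ⟨s, hs, hmin⟩ := isCompact_Icc.exists_isMinOn (s := Set.Icc (0 : ℝ) K)
    ⟨1, by simp [hK1]⟩ hvc.continuousOn
  have hle : ∀ t, 0 ≤ t → t ≤ K → v s ≤ v t := fun t h1 h2 => hmin ⟨h1, h2⟩
  have hvs : v s < 0 := by
    have h1 := hle 1 zero_le_one hK1
    simp only [hv] at h1 ⊢
    linarith
  have hv0 : v 0 = 0 := by simp [hv]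
  have hvK : 0 < v K := by
    have := h0 K
    simp only [hv]
    linarith
  set ρ := min s (K - s) with hρ
  have hρ1 : ρ ≤ s := min_le_left _ _
  have hρ2 : ρ ≤ K - s := min_le_right _ _
  have hρ0 : 0 ≤ ρ := le_min hs.1 (by linarith [hs.2])
  set w : EuclideanSpace ℝ (Fin n) → ℝ := fun z => v (s + ρ * z i) - v s with hw
  have hwc : Continuous w := by fun_prop
  have hint : ∀ {φ : EuclideanSpace ℝ (Fin n) → ℝ}, Continuous φ →
      IntegrableOn φ (unitCube n) volume :=
    fun hφ => hφ.continuousOn.integrableOn_compact (isCompact_unitCube n)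
  have hw0 : ∀ z ∈ unitCube n, 0 ≤ w z := by
    intro z hz
    have h1 := abs_le.1 (hz i)
    exact sub_nonneg.2 (hle _ (by nlinarith) (by nlinarith))
  have hmeas : MeasurableSet (unitCube n) := (isCompact_unitCube n).measurableSet
  have hwint : ∫ z in unitCube n, w z ≤ 0 := by
    have hweq : w = fun z => V (s + ρ * z i) + (m * ρ * z i - V s) := by
      ext z
      simp only [hw, hv]
      ring
    rw [hweq, integral_add (hint (by fun_prop)) (hint (by fun_prop)),
      integral_sub (hint (by fun_prop)) (hint (by fun_prop)), integral_const_mul,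
      setIntegral_unitCube_coord, setIntegral_const, smul_eq_mul]
    linarith [hmean s ρ]
  have hwnn : 0 ≤ᵐ[volume.restrict (unitCube n)] w :=
    (ae_restrict_iff' hmeas).2 (Filter.Eventually.of_forall hw0)
  have hwae : w =ᵐ[volume.restrict (unitCube n)] 0 :=
    (setIntegral_eq_zero_iff_of_nonneg_ae hwnn (hint hwc)).1
      (le_antisymm hwint (setIntegral_nonneg hmeas hw0))
  have hwz : Set.EqOn w 0 (unitCube n) :=
    Measure.eqOn_of_ae_eq hwae hwc.continuousOn continuousOn_const
      (unitCube_subset_closure_interior n)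
  have hmem : ∀ a : ℝ, |a| ≤ 1 → EuclideanSpace.single i a ∈ unitCube n := by
    intro a ha j
    by_cases hj : j = i
    · subst hj; simpa using ha
    · simp [hj]
  have h1 : v (s + ρ) = v s := by
    have := hwz (hmem 1 (by simp))
    simp only [hw, Pi.zero_apply, PiLp.single_apply, if_true, mul_one] at this
    linarith
  have h2 : v (s - ρ) = v s := by
    have := hwz (hmem (-1) (by simp))
    simp only [hw, Pi.zero_apply, PiLp.single_apply, if_true, mul_neg, mul_one,
      ← sub_eq_add_neg] at this
    linarith
  rcases min_choice s (K - s) with h | h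
  · rw [hρ, h, sub_self] at h2
    linarith
  · rw [hρ, h, add_sub_cancel] at h1
    linarith

/-- A nonnegative continuous function dominating its averages over all centered rectangles is
constant. -/
theorem eq_of_superMean_rectangles {n : ℕ} {u : EuclideanSpace ℝ (Fin n) → ℝ} (hu : Continuous u)
    (h0 : ∀ x, 0 ≤ u x)
    (h : ∀ (x : EuclideanSpace ℝ (Fin n)) (r : Fin n → ℝ), (∀ i, r i ≠ 0) →
      ∫ z in unitCube n, u (x + coordScale r z) ≤ u x * volume.real (unitCube n))
    (x y : EuclideanSpace ℝ (Fin n)) : u x = u y := by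
  have hdeg : ∀ (x : EuclideanSpace ℝ (Fin n)) (r : Fin n → ℝ),
      ∫ z in unitCube n, u (x + coordScale r z) ≤ u x * volume.real (unitCube n) :=
    fun x => setIntegral_unitCube_le_of_forall_ne_zero hu x (h x)
  have hline : ∀ (x : EuclideanSpace ℝ (Fin n)) (i : Fin n) (a : ℝ),
      u x ≤ u (x + EuclideanSpace.single i a) := by
    intro x i a
    have := le_of_superMean i (V := fun t => u (x + t • EuclideanSpace.single i a))
      (by fun_prop) (fun t => h0 _) (fun s ρ => by
        convert hdeg (x + s • EuclideanSpace.single i a) (Pi.single i (ρ * a)) using 4 with z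
        ext j
        by_cases hj : j = i
        · subst hj; simp; ring
        · simp [hj])
    simpa using this
  have hall : ∀ x y, u x ≤ u y := by
    intro x y
    have key : ∀ S : Finset (Fin n),
        u x ≤ u (x + ∑ i ∈ S, EuclideanSpace.single i ((y - x) i)) := by
      intro S
      induction S using Finset.induction_on with
      | empty => simp
      | insert i S hi ih =>
        rw [Finset.sum_insert hi, add_comm (EuclideanSpace.single i _), ← add_assoc]
        exact ih.trans (hline _ _ _)
    have hsum : x + ∑ i, EuclideanSpace.single i ((y - x) i) = y := by
      ext j
      simp [Finset.sum_apply]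
    simpa only [hsum] using key Finset.univ
  exact le_antisymm (hall x y) (hall y x)

theorem ofReal_convolution {n : ℕ} (φ : ContDiffBump (0 : EuclideanSpace ℝ (Fin n)))
    {g : EuclideanSpace ℝ (Fin n) → ℝ} (hg : LocallyIntegrable g volume) (h0 : ∀ x, 0 ≤ g x)
    (x : EuclideanSpace ℝ (Fin n)) :
    ENNReal.ofReal ((φ.normed volume ⋆[ContinuousLinearMap.lsmul ℝ ℝ, volume] g) x) =
      ∫⁻ t, ENNReal.ofReal (φ.normed volume t) * ENNReal.ofReal (g (x - t)) := by
  have hex := (φ.hasCompactSupport_normed (μ := volume)).convolutionExists_left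
    (ContinuousLinearMap.lsmul ℝ ℝ) φ.continuous_normed hg x
  rw [convolution_def, ofReal_integral_eq_lintegral_ofReal hex
    (Filter.Eventually.of_forall fun t => mul_nonneg (φ.nonneg_normed t) (h0 _))]
  exact lintegral_congr fun t => ofReal_mul (φ.nonneg_normed t)

/-- Mollification preserves the rectangular super-mean-value property. -/
theorem convolution_superMean {n : ℕ} (φ : ContDiffBump (0 : EuclideanSpace ℝ (Fin n)))
    {g : EuclideanSpace ℝ (Fin n) → ℝ} (hg : LocallyIntegrable g volume) (hgm : Measurable g)
    (h0 : ∀ x, 0 ≤ g x) {r : Fin n → ℝ}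
    (h : ∀ᵐ x, ∫⁻ z in unitCube n, ENNReal.ofReal (g (x + coordScale r z)) ≤
      ENNReal.ofReal (g x) * volume (unitCube n)) (x : EuclideanSpace ℝ (Fin n)) :
    ∫ z in unitCube n,
        (φ.normed volume ⋆[ContinuousLinearMap.lsmul ℝ ℝ, volume] g) (x + coordScale r z) ≤
      (φ.normed volume ⋆[ContinuousLinearMap.lsmul ℝ ℝ, volume] g) x *
        volume.real (unitCube n) := by
  set u := φ.normed volume ⋆[ContinuousLinearMap.lsmul ℝ ℝ, volume] g with hu
  have huc : Continuous u := φ.hasCompactSupport_normed.continuous_convolution_left _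
    φ.continuous_normed hg
  have hu0 : ∀ x, 0 ≤ u x := fun x =>
    integral_nonneg fun t => mul_nonneg (φ.nonneg_normed t) (h0 _)
  have hD : Continuous (coordScale r) := (coordScale r).continuous_of_finiteDimensional
  have hcu : volume (unitCube n) ≠ ∞ := (isCompact_unitCube n).measure_lt_top.ne
  have hint : IntegrableOn (fun z => u (x + coordScale r z)) (unitCube n) volume :=
    ContinuousOn.integrableOn_compact (isCompact_unitCube n) (by fun_prop)
  have hφm : Measurable fun t => ENNReal.ofReal (φ.normed volume t) :=
    φ.continuous_normed.measurable.ennreal_ofReal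
  have hae : ∀ᵐ t, ∫⁻ z in unitCube n, ENNReal.ofReal (g (x - t + coordScale r z)) ≤
      ENNReal.ofReal (g (x - t)) * volume (unitCube n) :=
    (quasiMeasurePreserving_sub_left volume x).ae h
  rw [← ENNReal.ofReal_le_ofReal_iff (mul_nonneg (hu0 x) measureReal_nonneg),
    ofReal_integral_eq_lintegral_ofReal hint (Filter.Eventually.of_forall fun z => hu0 _),
    ENNReal.ofReal_mul (hu0 x), ofReal_measureReal hcu]
  simp only [hu, ofReal_convolution φ hg h0]
  rw [lintegral_lintegral_swap, ← lintegral_mul_const'' _ (by fun_prop)]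
  · refine lintegral_mono_ae ?_
    filter_upwards [hae] with t ht
    rw [lintegral_const_mul _ (by fun_prop), mul_assoc]
    gcongr
    simpa only [sub_add_eq_add_sub] using ht
  · apply Measurable.aemeasurable
    exact (hφm.comp measurable_snd).mul (by fun_prop)

/-- A nonnegative locally integrable function dominating almost everywhere its averages over all
centered rectangles is almost everywhere constant. -/
theorem ae_eq_const_of_superMean {n : ℕ} {g : EuclideanSpace ℝ (Fin n) → ℝ}
    (hg : LocallyIntegrable g volume) (hgm : Measurable g) (h0 : ∀ x, 0 ≤ g x)
    (h : ∀ r : Fin n → ℝ, (∀ i, r i ≠ 0) →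
      ∀ᵐ x, ∫⁻ z in unitCube n, ENNReal.ofReal (g (x + coordScale r z)) ≤
        ENNReal.ofReal (g x) * volume (unitCube n)) :
    ∃ c : ℝ, g =ᵐ[volume] fun _ => c := by
  let φ : ℕ → ContDiffBump (0 : EuclideanSpace ℝ (Fin n)) := fun k =>
    { rIn := 1 / ((k : ℝ) + 1)
      rOut := 2 * (1 / ((k : ℝ) + 1))
      rIn_pos := by positivity
      rIn_lt_rOut := by
        have : 0 < 1 / ((k : ℝ) + 1) := by positivity
        linarith }
  have hφ : Filter.Tendsto (fun k => (φ k).rOut) Filter.atTop (nhds 0) := by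
    simpa only [mul_zero] using (tendsto_one_div_add_atTop_nhds_zero_nat (𝕜 := ℝ)).const_mul 2
  have hlim := ContDiffBump.ae_convolution_tendsto_right_of_locallyIntegrable (K := 2)
    (μ := volume) hφ (Filter.Eventually.of_forall fun k => le_rfl) hg
  have hconst : ∀ k x y,
      ((φ k).normed volume ⋆[ContinuousLinearMap.lsmul ℝ ℝ, volume] g) x =
        ((φ k).normed volume ⋆[ContinuousLinearMap.lsmul ℝ ℝ, volume] g) y := fun k =>
    eq_of_superMean_rectangles
      ((φ k).hasCompactSupport_normed.continuous_convolution_left _ (φ k).continuous_normed hg)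
      (fun x => integral_nonneg fun t => mul_nonneg ((φ k).nonneg_normed t) (h0 _))
      (fun x r hr => convolution_superMean (φ k) hg hgm h0 (h r hr) x)
  obtain ⟨x₀, hx₀⟩ := hlim.exists
  refine ⟨g x₀, ?_⟩
  filter_upwards [hlim] with x hx
  refine tendsto_nhds_unique hx (hx₀.congr fun k => hconst k x₀ x)

theorem average_le_strongMaximal {n : ℕ} (f : EuclideanSpace ℝ (Fin n) → ℝ)
    (x : EuclideanSpace ℝ (Fin n)) {r : Fin n → ℝ} (hr : ∀ i, 0 < r i) :
    (∫⁻ y in {y : EuclideanSpace ℝ (Fin n) | ∀ i, |y i - x i| ≤ r i},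
        ENNReal.ofReal |f y| ∂volume) /
      volume {y : EuclideanSpace ℝ (Fin n) | ∀ i, |y i - x i| ≤ r i} ≤ strongMaximal f x :=
  le_iSup₂_of_le r hr le_rfl

theorem ae_eq_zero_of_strongMaximal_eq_zero {n : ℕ} {f : EuclideanSpace ℝ (Fin n) → ℝ}
    (hf : AEMeasurable f volume) {x : EuclideanSpace ℝ (Fin n)} (hx : strongMaximal f x = 0) :
    f =ᵐ[volume] fun _ => 0 := by
  have hcover : (⋃ k : ℕ, {y : EuclideanSpace ℝ (Fin n) | ∀ i, |y i - x i| ≤ (k : ℝ) + 1}) =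
      Set.univ := by
    refine Set.eq_univ_of_forall fun y => ?_
    obtain ⟨k, hk⟩ := exists_nat_ge ‖y - x‖
    refine Set.mem_iUnion.2 ⟨k, fun i => ?_⟩
    have := PiLp.norm_apply_le (y - x) i
    rw [PiLp.sub_apply, Real.norm_eq_abs] at this
    linarith
  rw [← Measure.restrict_univ (μ := volume), ← hcover]
  refine (ae_restrict_iUnion_iff _ _).2 fun k => ?_
  have hle := average_le_strongMaximal f x (r := fun _ => (k : ℝ) + 1) fun _ => by positivity
  rw [hx, nonpos_iff_eq_zero, ENNReal.div_eq_zero_iff] at hle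
  have hz := hle.resolve_right (isCompact_rectangle x _).measure_lt_top.ne
  rw [lintegral_eq_zero_iff' (by fun_prop)] at hz
  filter_upwards [hz] with y hy
  simpa using hy

theorem statement17 (n : ℕ) (hn : 1 ≤ n) (f : EuclideanSpace ℝ (Fin n) → ℝ)
    (hf : LocallyIntegrable f volume)
    (hfix : ∀ᵐ x ∂(volume : Measure (EuclideanSpace ℝ (Fin n))),
      strongMaximal f x = ENNReal.ofReal (f x)) :
    ∃ c : ℝ, f =ᵐ[volume] fun _ => c := by
  have hfm : AEMeasurable f volume := hf.aestronglyMeasurable.aemeasurable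
  by_cases hpos : ∀ᵐ x, 0 < f x
  · set g : EuclideanSpace ℝ (Fin n) → ℝ := fun x => |hfm.mk f x| with hgdef
    have hfg : f =ᵐ[volume] g := by
      filter_upwards [hpos, hfm.ae_eq_mk] with x hx hx2
      simp only [hgdef]
      rw [← hx2, abs_of_pos hx]
    have hgm : Measurable g := by
      have := hfm.measurable_mk
      fun_prop
    have habs : ∀ᵐ y, ENNReal.ofReal |f y| = ENNReal.ofReal (g y) := by
      filter_upwards [hpos, hfg] with y hy hy2
      rw [abs_of_pos hy, hy2]
    obtain ⟨c, hc⟩ := ae_eq_const_of_superMean (hf.congr hfg) hgm (fun x => abs_nonneg _)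
      (fun r hr => by
        filter_upwards [hfix, hfg] with x hx hx2
        rw [setLIntegral_unitCube_comp_coordScale (g := fun y => ENNReal.ofReal (g y))
          hgm.ennreal_ofReal hr x, ← hx2, ← hx,
          ← lintegral_congr_ae (ae_restrict_of_ae habs)]
        gcongr
        exact average_le_strongMaximal f x fun i => abs_pos.2 (hr i))
    exact ⟨c, hfg.trans hc⟩
  · obtain ⟨x, hx, hx2⟩ := ((Filter.not_eventually.1 hpos).and_eventually hfix).exists
    refine ⟨0, ae_eq_zero_of_strongMaximal_eq_zero hfm (x := x) ?_⟩
    rw [hx2, ENNReal.ofReal_eq_zero]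
    exact not_lt.1 hx
end
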